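/- Fix a latent dimension m, N domains, and a probability mass function p on {1,…,N}. Let (g̃,(f̃_d)) and (g*,(f*_d)) be two ILDs with observation space ℝ^n, all component maps Borel measurable bijections with measurable inverses, which are distributionally equivalent, with μ_d the common pushforward of γ under g* ∘ f*_d. Assume g̃ is L̃-Lipschitz and g* is L*-Lipschitz, and assume both ILDs are in canonical position with sparsities k̃ and k*: for every i ≤ m − k̃ and all d, d', the i-th coordinate functions of f̃_d and f̃_{d'} coincide, and for every i ≤ m − k* and all d, d', the i-th coordinate functions of f*_d and f*_{d'} coincide. Then the counterfactual pseudo-metric d_C associated with p and (μ_d) satisfies d_C((g̃,F̃),(g*,F*))² ≤ 2 L̃² k̃ max_{1 ≤ i ≤ m} Σ_{d,d'} p(d) p(d') ∫ ( f̃_d(ε)_i − f̃_{d'}(ε)_i )² dγ(ε) + 2 L*² k* max_{1 ≤ i ≤ m} Σ_{d,d'} p(d) p(d') ∫ ( f*_d(ε)_i − f*_{d'}(ε)_i )² dγ(ε). -/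

import Mathlib

open MeasureTheory ProbabilityTheory
open scoped ENNReal

/-- A map `f : ℝ^m → ℝ^m` is autoregressive if each output coordinate depends only on the
input coordinates with index at most its own. -/
def Autoregressive (m : ℕ)
    (f : EuclideanSpace ℝ (Fin m) → EuclideanSpace ℝ (Fin m)) : Prop :=
  ∀ (j : Fin m) (x y : EuclideanSpace ℝ (Fin m)), (∀ i, i ≤ j → x i = y i) → f x j = f y j

/-- An invertible latent domain causal model (ILD) with latent dimension `m`, `N` domains,
and observation space `ℝ^n` (with Euclidean norm). -/
structure ILD (m N n : ℕ) where
  g : EuclideanSpace ℝ (Fin m) ≃ EuclideanSpace ℝ (Fin n)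
  f : Fin N → EuclideanSpace ℝ (Fin m) ≃ EuclideanSpace ℝ (Fin m)
  hauto : ∀ d, Autoregressive m (f d)

/-- All component maps of the ILD are Borel measurable bijections with measurable
inverses. -/
def MeasILD {m N n : ℕ} (M : ILD m N n) : Prop :=
  Measurable ⇑M.g ∧ Measurable ⇑M.g.symm ∧
    (∀ d, Measurable ⇑(M.f d)) ∧ ∀ d, Measurable ⇑(M.f d).symm

/-- The standard Gaussian measure on `ℝ^m`: the `m`-fold product of `N(0,1)`. -/
noncomputable def stdGaussian (m : ℕ) : Measure (EuclideanSpace ℝ (Fin m)) :=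
  (Measure.pi fun _ : Fin m => gaussianReal 0 1).map (MeasurableEquiv.toLp 2 (Fin m → ℝ))

/-- The counterfactual pseudo-metric between two ILDs, relative to domain weights `p`
and domain distributions `μ_d`: the square root of the expected squared distance between
the domain counterfactuals of the two models. -/
noncomputable def dC {m N n : ℕ} (p : Fin N → ℝ≥0∞)
    (μ : Fin N → Measure (EuclideanSpace ℝ (Fin n)))
    (M M' : ILD m N n) : ℝ≥0∞ :=
  (∑ d : Fin N, ∑ d' : Fin N, p d * p d' *
    ∫⁻ x, (‖M.g (M.f d' ((M.f d).symm (M.g.symm x))) -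
      M'.g (M'.f d' ((M'.f d).symm (M'.g.symm x)))‖₊ : ℝ≥0∞) ^ 2 ∂(μ d)) ^ (1/2 : ℝ)

/-- The domain counterfactual of an ILD: transport an observation to another domain. -/
def ILD.counterfactual {m N n : ℕ} (M : ILD m N n) (d d' : Fin N)
    (x : EuclideanSpace ℝ (Fin n)) : EuclideanSpace ℝ (Fin n) :=
  M.g (M.f d' ((M.f d).symm (M.g.symm x)))

lemma MeasILD.measurable_counterfactual {m N n : ℕ} {M : ILD m N n} (hM : MeasILD M)
    (d d' : Fin N) : Measurable (M.counterfactual d d') :=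
  hM.1.comp ((hM.2.2.1 d').comp ((hM.2.2.2 d).comp hM.2.1))

lemma MeasILD.measurable_enorm_counterfactual_sub_sq {m N n : ℕ} {M : ILD m N n}
    (hM : MeasILD M) (d d' : Fin N) :
    Measurable fun x => ‖M.counterfactual d d' x - x‖ₑ ^ 2 :=
  ((hM.measurable_counterfactual d d').sub measurable_id).enorm.pow_const 2

/-- The squared triangle inequality `‖x - z‖² ≤ 2 ‖x - y‖² + 2 ‖z - y‖²`. -/
lemma enorm_sub_sq_le_two_mul_add {E : Type*} [SeminormedAddCommGroup E] (x y z : E) :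
    ‖x - z‖ₑ ^ 2 ≤ 2 * ‖x - y‖ₑ ^ 2 + 2 * ‖z - y‖ₑ ^ 2 := by
  have hreal : ‖x - z‖ ^ 2 ≤ 2 * ‖x - y‖ ^ 2 + 2 * ‖z - y‖ ^ 2 := by
    have h := norm_sub_le (x - y) (z - y)
    rw [sub_sub_sub_cancel_right] at h
    nlinarith [norm_nonneg (x - z), sq_nonneg (‖x - y‖ - ‖z - y‖)]
  simp only [← ofReal_norm]
  rw [← ENNReal.ofReal_pow (norm_nonneg _), ← ENNReal.ofReal_pow (norm_nonneg _),
    ← ENNReal.ofReal_pow (norm_nonneg _), ← ENNReal.ofReal_ofNat 2,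
    ← ENNReal.ofReal_mul (by norm_num), ← ENNReal.ofReal_mul (by norm_num),
    ← ENNReal.ofReal_add (by positivity) (by positivity)]
  exact ENNReal.ofReal_le_ofReal hreal

/-- A sum over `Fin m` supported on the last `k` indices is at most `k` times the supremum. -/
lemma Fin.sum_le_mul_iSup_of_eq_zero {m : ℕ} (k : ℕ) (a : Fin m → ℝ≥0∞)
    (ha : ∀ i : Fin m, (i : ℕ) < m - k → a i = 0) : ∑ i, a i ≤ k * ⨆ i, a i := by
  classical
  set s : Finset (Fin m) := Finset.univ.filter fun i => ¬ (i : ℕ) < m - k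
  have hs : s.card ≤ k := by
    have hmap : s.card ≤ (Finset.Ico (m - k) m).card := by
      refine Finset.card_le_card_of_injOn Fin.val (fun i hi => ?_) Fin.val_injective.injOn
      have hi' : ¬ (i : ℕ) < m - k := by simpa [s] using hi
      simp only [Finset.coe_Ico, Set.mem_Ico]
      omega
    rw [Nat.card_Ico] at hmap
    omega
  calc ∑ i, a i = ∑ i ∈ s, a i := by
        refine (Finset.sum_subset (Finset.subset_univ s) fun i _ hi => ha i ?_).symm
        simpa only [s, Finset.mem_filter_univ, not_not] using hi
    _ ≤ s.card • ⨆ i, a i := Finset.sum_le_card_nsmul _ _ _ fun i _ => le_iSup a i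
    _ ≤ k * ⨆ i, a i := by
        rw [nsmul_eq_mul]
        gcongr

/-- A Lipschitz map into a normed space, in coordinates of the Euclidean source. -/
lemma enorm_sub_sq_le_of_lipschitz {m : ℕ} {E : Type*} [SeminormedAddCommGroup E]
    {g : EuclideanSpace ℝ (Fin m) → E} {L : ℝ} (hL : ∀ x y, ‖g x - g y‖ ≤ L * ‖x - y‖)
    (x y : EuclideanSpace ℝ (Fin m)) :
    ‖g x - g y‖ₑ ^ 2 ≤ ENNReal.ofReal (L ^ 2) * ∑ i, ENNReal.ofReal ((x i - y i) ^ 2) := by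
  rw [← ENNReal.ofReal_sum_of_nonneg fun i _ => sq_nonneg _,
    ← ENNReal.ofReal_mul (sq_nonneg L), ← ofReal_norm, ← ENNReal.ofReal_pow (norm_nonneg _)]
  refine ENNReal.ofReal_le_ofReal ?_
  calc ‖g x - g y‖ ^ 2 ≤ (L * ‖x - y‖) ^ 2 := by
        gcongr
        exact hL x y
    _ = L ^ 2 * ∑ i, (x i - y i) ^ 2 := by
        rw [mul_pow, EuclideanSpace.real_norm_sq_eq]
        simp

/-- The expected squared displacement of the domain counterfactuals of a canonically sparse
ILD with Lipschitz mixing function. -/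
lemma ILD.sum_lintegral_counterfactual_sub_le {m N n : ℕ} (p : Fin N → ℝ≥0∞) (M : ILD m N n)
    (hM : MeasILD M) (γ : Measure (EuclideanSpace ℝ (Fin m))) (L : ℝ)
    (hL : ∀ x y, ‖M.g x - M.g y‖ ≤ L * ‖x - y‖) (k : ℕ)
    (hk : ∀ i : Fin m, (i : ℕ) < m - k →
      ∀ (d d' : Fin N) (ε : EuclideanSpace ℝ (Fin m)), M.f d ε i = M.f d' ε i) :
    ∑ d, ∑ d', p d * p d' * ∫⁻ x, ‖M.counterfactual d d' x - x‖ₑ ^ 2 ∂(γ.map (M.g ∘ M.f d)) ≤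
      ENNReal.ofReal (L ^ 2) * k * ⨆ i : Fin m, ∑ d, ∑ d', p d * p d' *
        ∫⁻ ε, ENNReal.ofReal ((M.f d ε i - M.f d' ε i) ^ 2) ∂γ := by
  have hmeas (i : Fin m) (d d' : Fin N) :
      Measurable fun ε => ENNReal.ofReal ((M.f d ε i - M.f d' ε i) ^ 2) := by
    have hd := hM.2.2.1 d
    have hd' := hM.2.2.1 d'
    fun_prop
  have hle (d d' : Fin N) :
      ∫⁻ x, ‖M.counterfactual d d' x - x‖ₑ ^ 2 ∂(γ.map (M.g ∘ M.f d)) ≤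
        ENNReal.ofReal (L ^ 2) *
          ∑ i, ∫⁻ ε, ENNReal.ofReal ((M.f d ε i - M.f d' ε i) ^ 2) ∂γ := by
    rw [lintegral_map (hM.measurable_enorm_counterfactual_sub_sq d d')
      (hM.1.comp (hM.2.2.1 d)), ← lintegral_finsetSum _ fun i _ => hmeas i d d',
      ← lintegral_const_mul _ (Finset.measurable_fun_sum _ fun i _ => hmeas i d d')]
    refine lintegral_mono fun ε => ?_
    simp only [ILD.counterfactual, Function.comp_apply, Equiv.symm_apply_apply]
    rw [← enorm_neg, neg_sub]
    exact enorm_sub_sq_le_of_lipschitz hL _ _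
  calc _ ≤ ∑ d, ∑ d', p d * p d' * (ENNReal.ofReal (L ^ 2) *
          ∑ i, ∫⁻ ε, ENNReal.ofReal ((M.f d ε i - M.f d' ε i) ^ 2) ∂γ) := by
        gcongr with d _ d' _
        exact hle d d'
    _ = ENNReal.ofReal (L ^ 2) * ∑ i, ∑ d, ∑ d', p d * p d' *
          ∫⁻ ε, ENNReal.ofReal ((M.f d ε i - M.f d' ε i) ^ 2) ∂γ := by
        rw [Finset.sum_comm (s := (Finset.univ : Finset (Fin m))), Finset.mul_sum]
        refine Finset.sum_congr rfl fun d _ => ?_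
        rw [Finset.sum_comm (s := (Finset.univ : Finset (Fin m))), Finset.mul_sum]
        refine Finset.sum_congr rfl fun d' _ => ?_
        rw [← Finset.mul_sum]
        ring
    _ ≤ _ := by
        rw [mul_assoc]
        gcongr
        refine Fin.sum_le_mul_iSup_of_eq_zero k _ fun i hi => ?_
        refine Finset.sum_eq_zero fun d _ => Finset.sum_eq_zero fun d' _ => ?_
        simp [hk i hi d d']

/-- Worst-case counterfactual error bound for distributionally equivalent, canonically
sparse ILDs with Lipschitz mixing functions: the squared counterfactual pseudo-metric is
bounded by
`2 L̃² k̃ max_i Σ p p' ∫ (f̃_d(ε)_i − f̃_{d'}(ε)_i)² dγ + 2 L*² k* max_i Σ p p' ∫ (f*_d(ε)_i − f*_{d'}(ε)_i)² dγ`. -/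
theorem stmt17 (m N n : ℕ) (p : Fin N → ℝ≥0∞) (hp : ∑ d, p d = 1)
    (Mt Ms : ILD m N n) (hMt : MeasILD Mt) (hMs : MeasILD Ms)
    (μ : Fin N → Measure (EuclideanSpace ℝ (Fin n)))
    (hμ : ∀ d, μ d = (stdGaussian m).map (⇑Ms.g ∘ ⇑(Ms.f d)))
    (hdist : ∀ d, (stdGaussian m).map (⇑Mt.g ∘ ⇑(Mt.f d)) = μ d)
    (Lt Ls : ℝ)
    (hLt : ∀ x y, ‖Mt.g x - Mt.g y‖ ≤ Lt * ‖x - y‖)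
    (hLs : ∀ x y, ‖Ms.g x - Ms.g y‖ ≤ Ls * ‖x - y‖)
    (kt ks : ℕ)
    (hkt : ∀ i : Fin m, (i : ℕ) < m - kt →
      ∀ (d d' : Fin N) (ε : EuclideanSpace ℝ (Fin m)), Mt.f d ε i = Mt.f d' ε i)
    (hks : ∀ i : Fin m, (i : ℕ) < m - ks →
      ∀ (d d' : Fin N) (ε : EuclideanSpace ℝ (Fin m)), Ms.f d ε i = Ms.f d' ε i) :
    dC p μ Mt Ms ^ 2 ≤
      2 * ENNReal.ofReal (Lt ^ 2) * (kt : ℝ≥0∞) *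
        (⨆ i : Fin m, ∑ d : Fin N, ∑ d' : Fin N, p d * p d' *
          ∫⁻ ε, ENNReal.ofReal ((Mt.f d ε i - Mt.f d' ε i) ^ 2) ∂(stdGaussian m)) +
      2 * ENNReal.ofReal (Ls ^ 2) * (ks : ℝ≥0∞) *
        ⨆ i : Fin m, ∑ d : Fin N, ∑ d' : Fin N, p d * p d' *
          ∫⁻ ε, ENNReal.ofReal ((Ms.f d ε i - Ms.f d' ε i) ^ 2) ∂(stdGaussian m) := by
  have hsq : dC p μ Mt Ms ^ 2 = ∑ d, ∑ d', p d * p d' *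
      ∫⁻ x, ‖Mt.counterfactual d d' x - Ms.counterfactual d d' x‖ₑ ^ 2 ∂(μ d) := by
    rw [dC, ← ENNReal.rpow_natCast, ← ENNReal.rpow_mul]
    norm_num
    rfl
  have hle (d d' : Fin N) :
      ∫⁻ x, ‖Mt.counterfactual d d' x - Ms.counterfactual d d' x‖ₑ ^ 2 ∂(μ d) ≤
        2 * ∫⁻ x, ‖Mt.counterfactual d d' x - x‖ₑ ^ 2 ∂(μ d) +
          2 * ∫⁻ x, ‖Ms.counterfactual d d' x - x‖ₑ ^ 2 ∂(μ d) := by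
    have ht := hMt.measurable_enorm_counterfactual_sub_sq d d'
    have hs := hMs.measurable_enorm_counterfactual_sub_sq d d'
    calc _ ≤ ∫⁻ x, 2 * ‖Mt.counterfactual d d' x - x‖ₑ ^ 2 +
            2 * ‖Ms.counterfactual d d' x - x‖ₑ ^ 2 ∂(μ d) :=
          lintegral_mono fun x => enorm_sub_sq_le_two_mul_add _ x _
      _ = _ := by
          rw [lintegral_add_left (ht.const_mul 2)]
          congr 1
          · exact lintegral_const_mul 2 ht
          · exact lintegral_const_mul 2 hs
  have hboundt := ILD.sum_lintegral_counterfactual_sub_le p Mt hMt (stdGaussian m) Lt hLt kt hkt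
  have hbounds := ILD.sum_lintegral_counterfactual_sub_le p Ms hMs (stdGaussian m) Ls hLs ks hks
  simp only [hdist] at hboundt
  simp only [← hμ] at hbounds
  calc dC p μ Mt Ms ^ 2
      ≤ ∑ d, ∑ d', p d * p d' * (2 * ∫⁻ x, ‖Mt.counterfactual d d' x - x‖ₑ ^ 2 ∂(μ d) +
          2 * ∫⁻ x, ‖Ms.counterfactual d d' x - x‖ₑ ^ 2 ∂(μ d)) := by
        rw [hsq]
        gcongr with d _ d' _
        exact hle d d'
    _ = 2 * (∑ d, ∑ d', p d * p d' * ∫⁻ x, ‖Mt.counterfactual d d' x - x‖ₑ ^ 2 ∂(μ d)) +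
          2 * ∑ d, ∑ d', p d * p d' * ∫⁻ x, ‖Ms.counterfactual d d' x - x‖ₑ ^ 2 ∂(μ d) := by
        simp only [Finset.mul_sum, ← Finset.sum_add_distrib]
        refine Finset.sum_congr rfl fun d _ => Finset.sum_congr rfl fun d' _ => ?_
        ring
    _ ≤ _ := by
        simp only [mul_assoc] at hboundt hbounds ⊢
        gcongr
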